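/- Let λ > 0 and A > 0 with A + λ > e, and let P_{X*} be a capacity-achieving input distribution of the amplitude-constrained discrete-time Poisson channel. Then the support of P_{X*} is finite and |supp(P_{X*})| ≤ ⌊3 + log(1 + (e(A+λ) + 2λ) e^{2(e(A+λ)+λ)} log((A+λ)/λ))⌋. -/

import Mathlib

open MeasureTheory Real Set

noncomputable section

/-- Poisson transition pmf with dark current `lam`:
`P_{Y|X}(y|x) = (x+lam)^y e^{-(x+lam)} / y!` (with the convention `0^0 = 1`). -/
def channelPMF (lam x : ℝ) (y : ℕ) : ℝ :=
  (x + lam) ^ y * Real.exp (-(x + lam)) / (Nat.factorial y)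

/-- Output pmf induced by the input distribution `μ`. -/
def outputPMF (lam : ℝ) (μ : Measure ℝ) (y : ℕ) : ℝ :=
  ∫ x, channelPMF lam x y ∂μ

/-- Kullback–Leibler divergence between pmfs on `ℕ` (natural logarithm). -/
def klDiv (p q : ℕ → ℝ) : ℝ :=
  ∑' y, p y * Real.log (p y / q y)

/-- The function `i(x; μ) = D(P_{Y|X}(·|x) ‖ P_Y^μ)`. -/
def iFun (lam : ℝ) (μ : Measure ℝ) (x : ℝ) : ℝ :=
  klDiv (channelPMF lam x) (outputPMF lam μ)

/-- Mutual information for input distribution `μ`. -/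
def mutualInfo (lam : ℝ) (μ : Measure ℝ) : ℝ :=
  ∫ x, iFun lam μ x ∂μ

/-- Admissible input distributions: probability measures supported in `[0, A]`. -/
def IsInput (A : ℝ) (μ : Measure ℝ) : Prop :=
  IsProbabilityMeasure μ ∧ μ (Set.Icc 0 A)ᶜ = 0

/-- The capacity `C(A, lam)` of the amplitude-constrained Poisson channel. -/
def capacity (A lam : ℝ) : ℝ :=
  sSup (mutualInfo lam '' {μ : Measure ℝ | IsInput A μ})

/-- A capacity-achieving input distribution. -/
def IsCapacityAchieving (A lam : ℝ) (μ : Measure ℝ) : Prop :=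
  IsInput A μ ∧ mutualInfo lam μ = capacity A lam

/-- Topological support of a measure on `ℝ`. -/
def msupport (μ : Measure ℝ) : Set ℝ :=
  {x | ∀ U : Set ℝ, IsOpen U → x ∈ U → 0 < μ U}

open scoped Nat

section ExponentialGeneratingFunction

/-- Sequences of at most exponential growth. -/
def ExpGrowth (c : ℕ → ℝ) : Prop :=
  ∃ B r : ℝ, 0 ≤ r ∧ ∀ k, |c k| ≤ B * r ^ k

/-- The exponential generating function of a real sequence. -/
def egf (𝕜 : Type*) [RCLike 𝕜] (c : ℕ → ℝ) (z : 𝕜) : 𝕜 :=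
  ∑' k, ((c k / k ! : ℝ) : 𝕜) * z ^ k

lemma ExpGrowth.of_bounded {c : ℕ → ℝ} (B : ℝ) (h : ∀ k, |c k| ≤ B) : ExpGrowth c :=
  ⟨B, 1, zero_le_one, by simpa using h⟩

lemma ExpGrowth.const_one : ExpGrowth fun _ => 1 :=
  .of_bounded 1 (by simp)

lemma ExpGrowth.shift {c : ℕ → ℝ} (h : ExpGrowth c) : ExpGrowth fun k => c (k + 1) := by
  obtain ⟨B, r, hr, hc⟩ := h
  exact ⟨B * r, r, hr, fun k => (hc (k + 1)).trans_eq (by ring)⟩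

lemma ExpGrowth.sub {c d : ℕ → ℝ} (hc : ExpGrowth c) (hd : ExpGrowth d) :
    ExpGrowth fun k => c k - d k := by
  obtain ⟨B, r, hr, hc⟩ := hc
  obtain ⟨B', r', hr', hd⟩ := hd
  refine ⟨|B| + |B'|, max r r', le_max_of_le_left hr, fun k => ?_⟩
  have h1 : B * r ^ k ≤ |B| * max r r' ^ k := by
    gcongr
    · exact le_abs_self B
    · exact le_max_left _ _
  have h2 : B' * r' ^ k ≤ |B'| * max r r' ^ k := by
    gcongr
    · exact le_abs_self B'
    · exact le_max_right _ _
  have := abs_sub (c k) (d k)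
  linarith [hc k, hd k]

lemma ExpGrowth.of_abs_sub_le {c : ℕ → ℝ} (D : ℝ) (h : ∀ k, |c (k + 1) - c k| ≤ D) :
    ExpGrowth c := by
  have hD : 0 ≤ D := (abs_nonneg _).trans (h 0)
  refine ⟨|c 0| + D, 2, zero_le_two, fun k => ?_⟩
  induction k with
  | zero => simpa using hD
  | succ k ih =>
    have h1 := abs_add_le (c (k + 1) - c k) (c k)
    have h2 : (1 : ℝ) ≤ 2 ^ k := one_le_pow₀ one_le_two
    have h3 := h k
    rw [sub_add_cancel] at h1
    rw [pow_succ]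
    nlinarith [abs_nonneg (c 0), mul_nonneg (abs_nonneg (c 0)) (zero_le_one.trans h2)]

lemma ExpGrowth.natCast : ExpGrowth fun k => (k : ℝ) :=
  .of_abs_sub_le 1 (by simp)

lemma ExpGrowth.summable_abs {c : ℕ → ℝ} (h : ExpGrowth c) {R : ℝ} (hR : 0 ≤ R) :
    Summable fun k => |c k| / k ! * R ^ k := by
  obtain ⟨B, r, hr, hc⟩ := h
  refine Summable.of_nonneg_of_le (fun k => by positivity) (fun k => ?_)
    ((Real.summable_pow_div_factorial (r * R)).mul_left B)
  calc |c k| / k ! * R ^ k ≤ B * r ^ k / k ! * R ^ k := by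
        gcongr
        exact hc k
    _ = _ := by rw [mul_pow]; ring

variable {𝕜 : Type*} [RCLike 𝕜]

lemma norm_egf_term (c : ℕ → ℝ) (z : 𝕜) (k : ℕ) :
    ‖((c k / k ! : ℝ) : 𝕜) * z ^ k‖ = |c k| / k ! * ‖z‖ ^ k := by
  rw [norm_mul, norm_pow, RCLike.norm_ofReal, abs_div, Nat.abs_cast]

lemma ExpGrowth.summable {c : ℕ → ℝ} (h : ExpGrowth c) (z : 𝕜) :
    Summable fun k => ((c k / k ! : ℝ) : 𝕜) * z ^ k := by
  refine Summable.of_norm ?_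
  simp_rw [norm_egf_term]
  exact h.summable_abs (norm_nonneg z)

lemma ExpGrowth.hasDerivAt_egf {c : ℕ → ℝ} (h : ExpGrowth c) (z : 𝕜) :
    HasDerivAt (egf 𝕜 c) (egf 𝕜 (fun k => c (k + 1)) z) z := by
  set R := ‖z‖ + 1
  have hR : 0 ≤ R := by positivity
  have hfac (k : ℕ) (x : ℝ) : x / (k + 1)! * ((k + 1 : ℕ) : ℝ) = x / k ! := by
    rw [Nat.factorial_succ]
    push_cast
    field_simp
  have key := hasDerivAt_tsum_of_isPreconnected (𝕜 := 𝕜)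
    (g := fun k (z : 𝕜) => ((c k / k ! : ℝ) : 𝕜) * z ^ k)
    (g' := fun k (z : 𝕜) => ((c k / k ! : ℝ) : 𝕜) * (k * z ^ (k - 1)))
    (u := fun k => |c k| / k ! * (k * R ^ (k - 1)))
    (t := Metric.ball 0 R) (y₀ := 0) (y := z) ?_ Metric.isOpen_ball
    (convex_ball (0 : 𝕜) R).isPreconnected
    (fun k y _ => (hasDerivAt_pow k y).const_mul _) (fun k y hy => ?_)
    (Metric.mem_ball_self (by positivity)) (h.summable 0)
    (by simp [R])
  · refine key.congr_deriv ?_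
    rw [tsum_eq_zero_add']
    · simp only [CharP.cast_eq_zero, zero_mul, mul_zero, zero_add, add_tsub_cancel_right]
      refine tsum_congr fun k => ?_
      rw [← hfac k (c (k + 1)), ← mul_assoc]
      push_cast
      rfl
    · refine (h.shift.summable z).congr fun k => ?_
      rw [← hfac k (c (k + 1)), ← mul_assoc]
      push_cast
      rfl
  · rw [← summable_nat_add_iff 1]
    refine (h.shift.summable_abs hR).congr fun k => ?_
    rw [← hfac k |c (k + 1)|, ← mul_assoc]
    simp
  · rw [norm_mul, norm_mul, norm_pow, RCLike.norm_ofReal, abs_div, Nat.abs_cast,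
      RCLike.norm_natCast]
    have : ‖y‖ ≤ R := by simpa using (mem_ball_zero_iff.1 hy).le
    gcongr

lemma norm_egf_le {c : ℕ → ℝ} {B : ℝ} (h : ∀ k, |c k| ≤ B) (z : 𝕜) :
    ‖egf 𝕜 c z‖ ≤ B * Real.exp ‖z‖ := by
  have hs : HasSum (fun k : ℕ => B * (‖z‖ ^ k / k !)) (B * Real.exp ‖z‖) := by
    have := (NormedSpace.expSeries_div_hasSum_exp ‖z‖).mul_left B
    rwa [← congrFun Real.exp_eq_exp_ℝ] at this
  refine tsum_of_norm_bounded hs fun k => ?_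
  rw [norm_egf_term, div_mul_eq_mul_div, mul_div_assoc]
  gcongr
  exact h k

lemma ofReal_egf (c : ℕ → ℝ) (x : ℝ) : ((egf ℝ c x : ℝ) : ℂ) = egf ℂ c x := by
  simp [egf, Complex.ofReal_tsum]

lemma egf_sub {c d : ℕ → ℝ} (hc : ExpGrowth c) (hd : ExpGrowth d) (z : 𝕜) :
    egf 𝕜 (fun k => c k - d k) z = egf 𝕜 c z - egf 𝕜 d z := by
  rw [egf, egf, egf, ← (hc.summable z).tsum_sub (hd.summable z)]
  refine tsum_congr fun k => ?_
  push_cast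
  ring

/-- The derivative of the Poisson mean of a sequence is the Poisson mean of its differences. -/
lemma ExpGrowth.hasDerivAt_exp_neg_mul_egf {c : ℕ → ℝ} (h : ExpGrowth c) (y : ℝ) :
    HasDerivAt (fun y => Real.exp (-y) * egf ℝ c y)
      (Real.exp (-y) * egf ℝ (fun k => c (k + 1) - c k) y) y := by
  refine ((hasDerivAt_neg y).exp.mul (h.hasDerivAt_egf y)).congr_deriv ?_
  rw [egf_sub h.shift h]
  ring

lemma egf_one (y : ℝ) : egf ℝ (fun _ => 1) y = Real.exp y := by
  have := (NormedSpace.expSeries_div_hasSum_exp y).tsum_eq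
  rw [← congrFun Real.exp_eq_exp_ℝ] at this
  rw [← this, egf]
  refine tsum_congr fun k => ?_
  simp
  ring

lemma egf_natCast (y : ℝ) : egf ℝ (fun k => (k : ℝ)) y = y * Real.exp y := by
  have hk (k : ℕ) : ((((k + 1 : ℕ) : ℝ) / (k + 1)! : ℝ) : ℝ) * y ^ (k + 1) =
      y * (((1 / k ! : ℝ) : ℝ) * y ^ k) := by
    rw [Nat.factorial_succ]
    push_cast
    field_simp
    ring
  rw [← egf_one, egf, egf, ← tsum_mul_left, tsum_eq_zero_add']
  · simp only [CharP.cast_eq_zero, RCLike.ofReal_real_eq_id, id, hk, zero_div, zero_mul, zero_add]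
  · simp only [RCLike.ofReal_real_eq_id, id, hk]
    exact (ExpGrowth.const_one.summable (𝕜 := ℝ) y).mul_left y

end ExponentialGeneratingFunction

section ZeroCounting

/-- Jensen-type bound: each zero in the disc of radius `R` costs a factor `ρ / R`. -/
lemma norm_mul_pow_card_le {R ρ M : ℝ} (hR : 0 < R) (hρ : R < ρ) (s : Finset ℂ) :
    ∀ f : ℂ → ℂ, Differentiable ℂ f → (∀ z, ‖z‖ = ρ → ‖f z‖ ≤ M) →
      (∀ a ∈ s, ‖a‖ ≤ R ∧ f a = 0) → ‖f 0‖ * (ρ / R) ^ s.card ≤ M := by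
  have hρ0 : 0 < ρ := hR.trans hρ
  induction s using Finset.induction_on with
  | empty =>
    intro f hf hM _
    simpa using Complex.norm_le_of_forall_mem_frontier_norm_le (U := Metric.ball 0 ρ)
      Metric.isBounded_ball hf.diffContOnCl
      (fun z hz => hM z (by simpa [frontier_ball _ hρ0.ne'] using hz))
      (subset_closure (Metric.mem_ball_self hρ0))
  | insert a s ha ih =>
    intro f hf hM hs
    obtain ⟨haR, hfa⟩ := hs a (Finset.mem_insert_self a s)
    have hM0 : 0 ≤ M := (norm_nonneg _).trans (hM ρ (by simp [abs_of_pos hρ0]))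
    rcases eq_or_ne a 0 with rfl | ha0
    · simpa [hfa] using hM0
    have hds (z : ℂ) (hz : z ≠ a) : dslope f a z = f z / (z - a) := by
      rw [dslope_of_ne _ hz, slope_def_field, hfa, sub_zero]
    have hd : Differentiable ℂ (dslope f a) := by
      rw [← differentiableOn_univ, Complex.differentiableOn_dslope Filter.univ_mem]
      exact hf.differentiableOn
    have key := ih (fun z => dslope f a z * ((ρ ^ 2 - (starRingEnd ℂ) a * z) / ρ))
      (hd.mul (by fun_prop)) ?_ ?_
    · have h0 : 0 < ‖a‖ := norm_pos_iff.2 ha0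
      rw [hds 0 ha0.symm] at key
      simp only [zero_sub, mul_zero, sub_zero, norm_mul, norm_div, norm_neg, norm_pow,
        Complex.norm_real, Real.norm_eq_abs, abs_of_pos hρ0] at key
      rw [Finset.card_insert_of_notMem ha, pow_succ]
      refine le_trans ?_ key
      calc ‖f 0‖ * ((ρ / R) ^ s.card * (ρ / R)) = ‖f 0‖ * (ρ / R) * (ρ / R) ^ s.card := by ring
        _ ≤ ‖f 0‖ * (ρ / ‖a‖) * (ρ / R) ^ s.card := by gcongr
        _ = _ := by field_simp
    · intro z hz
      have hza : z ≠ a := by rintro rfl; linarith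
      have hbl : ‖(ρ ^ 2 - (starRingEnd ℂ) a * z) / (ρ : ℂ)‖ = ‖z - a‖ := by
        have : (ρ : ℂ) ^ 2 - (starRingEnd ℂ) a * z = (starRingEnd ℂ) (z - a) * z := by
          rw [map_sub, sub_mul, Complex.conj_mul', hz]
        rw [this, norm_div, norm_mul, RCLike.norm_conj, hz, Complex.norm_real,
          Real.norm_eq_abs, abs_of_pos hρ0, mul_div_cancel_right₀ _ hρ0.ne']
      rw [norm_mul, hbl, hds z hza, norm_div,
        div_mul_cancel₀ _ (norm_ne_zero_iff.2 (sub_ne_zero.2 hza))]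
      exact hM z hz
    · intro b hb
      obtain ⟨hbR, hfb⟩ := hs b (Finset.mem_insert_of_mem hb)
      have hba : b ≠ a := by rintro rfl; exact ha hb
      exact ⟨hbR, by rw [hds b hba, hfb]; simp⟩

/-- The theorem of Rolle for a finite set of points of a level set. -/
lemma exists_finset_deriv_eq_zero {f f' : ℝ → ℝ} {D : Set ℝ} (hD : D.OrdConnected)
    (hf : ∀ x ∈ D, HasDerivAt f (f' x) x) {v : ℝ} (s : Finset ℝ) (hs : ∀ x ∈ s, x ∈ D ∧ f x = v) :
    ∃ t : Finset ℝ, (∀ x ∈ t, x ∈ D ∧ f' x = 0) ∧ s.card ≤ t.card + 1 := by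
  rcases hn : s.card with _ | n
  · exact ⟨∅, by simp, by simp⟩
  have hmem (i : Fin (n + 1)) := hs _ (s.orderEmbOfFin_mem hn i)
  have hex (i : Fin n) : ∃ c ∈ Set.Ioo (s.orderEmbOfFin hn i.castSucc) (s.orderEmbOfFin hn i.succ),
      c ∈ D ∧ f' c = 0 := by
    have hsub := hD.out (hmem i.castSucc).1 (hmem i.succ).1
    obtain ⟨c, hc, hc0⟩ := exists_hasDerivAt_eq_zero (f := f) (f' := f')
      ((s.orderEmbOfFin hn).strictMono i.castSucc_lt_succ)
      (fun x hx => (hf x (hsub hx)).continuousAt.continuousWithinAt)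
      ((hmem i.castSucc).2.trans (hmem i.succ).2.symm)
      (fun x hx => hf x (hsub (Set.Ioo_subset_Icc_self hx)))
    exact ⟨c, hc, hsub (Set.Ioo_subset_Icc_self hc), hc0⟩
  choose c hc hcD using hex
  have hmono : StrictMono c := fun i j hij =>
    (hc i).2.trans_le (((s.orderEmbOfFin hn).monotone (Fin.succ_le_castSucc_iff.2 hij)).trans
      (hc j).1.le)
  refine ⟨Finset.univ.image c, ?_, ?_⟩
  · simpa using hcD
  · rw [Finset.card_image_of_injective _ hmono.injective, Finset.card_fin]

end ZeroCounting

section PoissonChannel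

variable {A lam x : ℝ} {μ ν : Measure ℝ}

/-- Two-sided bounds satisfied by all pmfs which are mixtures of channel laws with inputs in
`[0, A]`. -/
def PoissonBounded (A lam : ℝ) (q : ℕ → ℝ) : Prop :=
  ∀ k, lam ^ k * Real.exp (-(A + lam)) / k ! ≤ q k ∧ q k ≤ (A + lam) ^ k * Real.exp (-lam) / k !

/-- The logarithms of the factorially weighted output probabilities. -/
def logOutput (lam : ℝ) (ν : Measure ℝ) (k : ℕ) : ℝ :=
  Real.log (k ! * outputPMF lam ν k)

/-- The information density averaged over the Poisson law of mean `y`, as a function of `y`. -/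
def infoFun (lam : ℝ) (ν : Measure ℝ) (y : ℝ) : ℝ :=
  y * Real.log y - y - Real.exp (-y) * egf ℝ (logOutput lam ν) y

lemma PoissonBounded.pos (hlam : 0 < lam) {q : ℕ → ℝ} (hq : PoissonBounded A lam q) (k : ℕ) :
    0 < q k :=
  lt_of_lt_of_le (by positivity) (hq k).1

lemma PoissonBounded.div_le (hlam : 0 < lam) (hA : 0 < A) {p q : ℕ → ℝ}
    (hp : PoissonBounded A lam p) (hq : PoissonBounded A lam q) (k : ℕ) :
    p k / q k ≤ Real.exp A * ((A + lam) / lam) ^ k := by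
  calc p k / q k ≤ ((A + lam) ^ k * Real.exp (-lam) / k !) /
        (lam ^ k * Real.exp (-(A + lam)) / k !) := by
        gcongr
        · exact (hp k).2
        · exact (hq k).1
    _ = _ := by
        rw [div_pow, show -lam = A + -(A + lam) by ring, Real.exp_add]
        field_simp

lemma expGrowth_ratio (hlam : 0 < lam) (hA : 0 < A) :
    ExpGrowth fun k => Real.exp A * ((A + lam) / lam) ^ k :=
  ⟨Real.exp A, (A + lam) / lam, by positivity, fun k => by rw [abs_of_nonneg (by positivity)]⟩

lemma PoissonBounded.expGrowth_div (hlam : 0 < lam) (hA : 0 < A) {p q : ℕ → ℝ}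
    (hp : PoissonBounded A lam p) (hq : PoissonBounded A lam q) :
    ExpGrowth fun k => p k / q k :=
  ⟨Real.exp A, (A + lam) / lam, by positivity, fun k => by
    rw [abs_of_pos (div_pos (hp.pos hlam k) (hq.pos hlam k))]
    exact hp.div_le hlam hA hq k⟩

lemma PoissonBounded.expGrowth_log_div (hlam : 0 < lam) (hA : 0 < A) {p q : ℕ → ℝ}
    (hp : PoissonBounded A lam p) (hq : PoissonBounded A lam q) :
    ExpGrowth fun k => Real.log (p k / q k) := by
  refine ⟨Real.exp A, (A + lam) / lam, by positivity, fun k => abs_le'.2 ⟨?_, ?_⟩⟩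
  · exact (Real.log_le_self (div_pos (hp.pos hlam k) (hq.pos hlam k)).le).trans
      (hp.div_le hlam hA hq k)
  · rw [← Real.log_inv, inv_div]
    exact (Real.log_le_self (div_pos (hq.pos hlam k) (hp.pos hlam k)).le).trans
      (hq.div_le hlam hA hp k)

lemma hasSum_channelPMF_mul {c : ℕ → ℝ} (hc : ExpGrowth c) :
    HasSum (fun k => channelPMF lam x k * c k)
      (Real.exp (-(x + lam)) * egf ℝ c (x + lam)) := by
  convert! (hc.summable (𝕜 := ℝ) (x + lam)).hasSum.mul_left (Real.exp (-(x + lam))) using 2 with k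
  simp [channelPMF]
  ring

lemma hasSum_channelPMF : HasSum (channelPMF lam x) 1 := by
  have := hasSum_channelPMF_mul (lam := lam) (x := x) ExpGrowth.const_one
  simpa [egf_one, ← Real.exp_add] using this

lemma hasSum_channelPMF_mul_natCast :
    HasSum (fun k => channelPMF lam x k * k) (x + lam) := by
  have := hasSum_channelPMF_mul (lam := lam) (x := x) ExpGrowth.natCast
  rwa [egf_natCast, mul_left_comm, ← Real.exp_add, neg_add_cancel, Real.exp_zero, mul_one] at this

lemma poissonBounded_channelPMF (hlam : 0 < lam) (hx : x ∈ Set.Icc 0 A) :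
    PoissonBounded A lam (channelPMF lam x) := by
  obtain ⟨h0, h1⟩ := hx
  have : 0 ≤ A + lam := by linarith
  refine fun k => ⟨?_, ?_⟩ <;> unfold channelPMF <;> gcongr <;> linarith

lemma IsInput.ae_mem (hν : IsInput A ν) : ∀ᵐ x ∂ν, x ∈ Set.Icc 0 A :=
  hν.2

lemma IsInput.integrable (hν : IsInput A ν) {g : ℝ → ℝ} (hg : ContinuousOn g (Set.Icc 0 A)) :
    Integrable g ν := by
  have := hν.1
  have h := hg.integrableOn_compact (μ := ν) isCompact_Icc
  rwa [IntegrableOn, Measure.restrict_eq_self_of_ae_mem hν.ae_mem] at h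

lemma continuous_channelPMF (k : ℕ) : Continuous fun x => channelPMF lam x k := by
  unfold channelPMF
  fun_prop

lemma IsInput.integrable_channelPMF (hν : IsInput A ν) (k : ℕ) :
    Integrable (fun x => channelPMF lam x k) ν :=
  hν.integrable (continuous_channelPMF k).continuousOn

lemma poissonBounded_outputPMF (hlam : 0 < lam) (hν : IsInput A ν) :
    PoissonBounded A lam (outputPMF lam ν) := by
  have := hν.1
  intro k
  have hb : ∀ᵐ x ∂ν, lam ^ k * Real.exp (-(A + lam)) / k ! ≤ channelPMF lam x k ∧
      channelPMF lam x k ≤ (A + lam) ^ k * Real.exp (-lam) / k ! :=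
    hν.ae_mem.mono fun x hx => poissonBounded_channelPMF hlam hx k
  constructor
  · simpa [outputPMF] using integral_mono_ae (integrable_const _) (hν.integrable_channelPMF k)
      (hb.mono fun x hx => hx.1)
  · simpa [outputPMF] using integral_mono_ae (hν.integrable_channelPMF k) (integrable_const _)
      (hb.mono fun x hx => hx.2)

/-- Averaging against the channel commutes with averaging against the input. -/
lemma IsInput.hasSum_outputPMF_mul (hlam : 0 < lam) (hA : 0 < A) (hν : IsInput A ν) {c : ℕ → ℝ}
    (hc : ExpGrowth c) :
    HasSum (fun k => outputPMF lam ν k * c k) (∫ x, ∑' k, channelPMF lam x k * c k ∂ν) := by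
  have := hν.1
  have hpos : ∀ᵐ x ∂ν, ∀ k, 0 ≤ channelPMF lam x k := hν.ae_mem.mono fun x hx k =>
    ((poissonBounded_channelPMF hlam hx).pos hlam k).le
  have key := hasSum_integral_of_summable_integral_norm (μ := ν)
    (F := fun k x => channelPMF lam x k * c k)
    (fun k => (hν.integrable_channelPMF k).mul_const _) ?_
  · simp only [integral_mul_const] at key
    exact key
  · have hnorm (k : ℕ) : ∫ x, ‖channelPMF lam x k * c k‖ ∂ν = outputPMF lam ν k * |c k| := by
      rw [outputPMF, ← integral_mul_const]
      refine integral_congr_ae (hpos.mono fun x hx => ?_)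
      simp only [norm_mul, Real.norm_eq_abs, abs_of_nonneg (hx k)]
    simp_rw [hnorm]
    refine Summable.of_nonneg_of_le (fun k => ?_) (fun k => ?_)
      ((hc.summable_abs (R := A + lam) (by positivity)).mul_left (Real.exp (-lam)))
    · have := (poissonBounded_outputPMF hlam hν).pos hlam k
      positivity
    · calc outputPMF lam ν k * |c k| ≤ (A + lam) ^ k * Real.exp (-lam) / k ! * |c k| := by
            gcongr
            exact (poissonBounded_outputPMF hlam hν k).2
        _ = _ := by ring

lemma IsInput.hasSum_outputPMF (hlam : 0 < lam) (hA : 0 < A) (hν : IsInput A ν) :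
    HasSum (outputPMF lam ν) 1 := by
  have := hν.1
  simpa [hasSum_channelPMF.tsum_eq] using hν.hasSum_outputPMF_mul hlam hA ExpGrowth.const_one

lemma IsInput.logOutput_succ_sub_mem (hlam : 0 < lam) (hν : IsInput A ν) (hA : 0 < A) (k : ℕ) :
    logOutput lam ν (k + 1) - logOutput lam ν k ∈ Set.Icc (Real.log lam) (Real.log (A + lam)) := by
  have hP := poissonBounded_outputPMF hlam hν
  have h0 : 0 < k ! * outputPMF lam ν k := mul_pos (by positivity) (hP.pos hlam k)
  have h1 : 0 < (k + 1)! * outputPMF lam ν (k + 1) := mul_pos (by positivity) (hP.pos hlam _)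
  have hfac (x : ℝ) : (k + 1)! * channelPMF lam x (k + 1) =
      (x + lam) * (k ! * channelPMF lam x k) := by
    simp only [channelPMF]
    field_simp
    ring
  have hk : ∀ᵐ x ∂ν, 0 ≤ k ! * channelPMF lam x k ∧ lam ≤ x + lam ∧ x + lam ≤ A + lam :=
    hν.ae_mem.mono fun x hx =>
      ⟨mul_nonneg (by positivity) ((poissonBounded_channelPMF hlam hx).pos hlam k).le,
        by linarith [hx.1], by linarith [hx.2]⟩
  have hi (k : ℕ) := (hν.integrable_channelPMF (lam := lam) k).const_mul (k ! : ℝ)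
  have hlow : lam * (k ! * outputPMF lam ν k) ≤ (k + 1)! * outputPMF lam ν (k + 1) := by
    simp only [outputPMF, ← integral_const_mul]
    refine integral_mono_ae ((hi k).const_mul _) (hi (k + 1)) (hk.mono fun x hx => ?_)
    simp only [hfac]
    exact mul_le_mul_of_nonneg_right hx.2.1 hx.1
  have hupp : (k + 1)! * outputPMF lam ν (k + 1) ≤ (A + lam) * (k ! * outputPMF lam ν k) := by
    simp only [outputPMF, ← integral_const_mul]
    refine integral_mono_ae (hi (k + 1)) ((hi k).const_mul _) (hk.mono fun x hx => ?_)
    simp only [hfac]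
    exact mul_le_mul_of_nonneg_right hx.2.2 hx.1
  have hl := Real.log_le_log (by positivity) hlow
  have hu := Real.log_le_log h1 hupp
  rw [Real.log_mul (by positivity) h0.ne'] at hl hu
  constructor <;> simp only [logOutput] <;> linarith

lemma IsInput.expGrowth_logOutput (hlam : 0 < lam) (hν : IsInput A ν) (hA : 0 < A) :
    ExpGrowth (logOutput lam ν) :=
  .of_abs_sub_le (max |Real.log lam| |Real.log (A + lam)|) fun k =>
    have h := hν.logOutput_succ_sub_mem hlam hA k
    abs_le_max_abs_abs h.1 h.2

lemma IsInput.expGrowth_logOutput_succ_sub (hlam : 0 < lam) (hν : IsInput A ν) (hA : 0 < A) :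
    ExpGrowth fun k => logOutput lam ν (k + 1) - logOutput lam ν k :=
  (hν.expGrowth_logOutput hlam hA).shift.sub (hν.expGrowth_logOutput hlam hA)

lemma IsInput.abs_logOutput_second_difference_le (hlam : 0 < lam) (hν : IsInput A ν) (hA : 0 < A)
    (k : ℕ) :
    |(logOutput lam ν (k + 1 + 1) - logOutput lam ν (k + 1)) -
      (logOutput lam ν (k + 1) - logOutput lam ν k)| ≤ Real.log ((A + lam) / lam) := by
  have h1 := hν.logOutput_succ_sub_mem hlam hA k
  have h2 := hν.logOutput_succ_sub_mem hlam hA (k + 1)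
  rw [Real.log_div (by positivity) hlam.ne']
  exact abs_sub_le_of_le_of_le h2.1 h2.2 h1.1 h1.2

lemma IsInput.iFun_eq_infoFun (hlam : 0 < lam) (hν : IsInput A ν) (hx : x ∈ Set.Icc 0 A)
    (hA : 0 < A) : iFun lam ν x = infoFun lam ν (x + lam) := by
  have hy : 0 < x + lam := by linarith [hx.1]
  have h := ((hasSum_channelPMF_mul_natCast (lam := lam) (x := x)).mul_right
    (Real.log (x + lam))).sub ((hasSum_channelPMF (lam := lam) (x := x)).mul_right (x + lam))
    |>.sub (hasSum_channelPMF_mul (lam := lam) (x := x) (hν.expGrowth_logOutput hlam hA))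
  rw [one_mul] at h
  refine Eq.trans (tsum_congr fun k => ?_) h.tsum_eq
  have hp := (poissonBounded_channelPMF hlam hx).pos hlam k
  have hP := (poissonBounded_outputPMF hlam hν).pos hlam k
  have hk : (0 : ℝ) < k ! := by positivity
  have hlog : Real.log (channelPMF lam x k) =
      k * Real.log (x + lam) - (x + lam) - Real.log (k !) := by
    rw [channelPMF, Real.log_div (by positivity) hk.ne', Real.log_mul (by positivity)
      (Real.exp_pos _).ne', Real.log_pow, Real.log_exp]
    ring
  rw [Real.log_div hp.ne' hP.ne', logOutput, Real.log_mul hk.ne' hP.ne', hlog]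
  ring

lemma IsInput.hasDerivAt_infoFun (hlam : 0 < lam) (hν : IsInput A ν) (hA : 0 < A) {y : ℝ}
    (hy : 0 < y) :
    HasDerivAt (infoFun lam ν) (Real.log y - Real.exp (-y) *
      egf ℝ (fun k => logOutput lam ν (k + 1) - logOutput lam ν k) y) y := by
  refine ((((hasDerivAt_id y).mul (Real.hasDerivAt_log hy.ne')).sub (hasDerivAt_id y)).sub
    ((hν.expGrowth_logOutput hlam hA).hasDerivAt_exp_neg_mul_egf y)).congr_deriv ?_
  simp [hy.ne']

lemma IsInput.continuousOn_iFun (hlam : 0 < lam) (hν : IsInput A ν) (hA : 0 < A) :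
    ContinuousOn (iFun lam ν) (Set.Icc 0 A) := by
  have h : ContinuousOn (fun x => infoFun lam ν (x + lam)) (Set.Icc 0 A) := fun x hx =>
    ((hν.hasDerivAt_infoFun hlam hA (by linarith [hx.1])).continuousAt.comp
      (f := fun x => x + lam) (by fun_prop)).continuousWithinAt
  exact h.congr fun x hx => hν.iFun_eq_infoFun hlam hx hA

lemma continuous_exp_neg_mul_egf {c : ℕ → ℝ} (hc : ExpGrowth c) :
    Continuous fun x => Real.exp (-(x + lam)) * egf ℝ c (x + lam) := by
  have h : Continuous (egf ℝ c) :=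
    continuous_iff_continuousAt.2 fun y => (hc.hasDerivAt_egf y).continuousAt
  fun_prop

lemma bddAbove_mutualInfo (hlam : 0 < lam) (hA : 0 < A) :
    BddAbove (mutualInfo lam '' {ν | IsInput A ν}) := by
  have hc := expGrowth_ratio hlam hA
  obtain ⟨K, hK⟩ := isCompact_Icc.exists_bound_of_continuousOn (s := Set.Icc 0 A)
    (continuous_exp_neg_mul_egf (lam := lam) hc).continuousOn
  refine ⟨K, ?_⟩
  rintro _ ⟨ν, hν, rfl⟩
  have hν : IsInput A ν := hν
  have := hν.1
  have hle : ∀ᵐ x ∂ν, iFun lam ν x ≤ K := hν.ae_mem.mono fun x hx => by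
    have hp := poissonBounded_channelPMF hlam hx
    have hP := poissonBounded_outputPMF hlam hν
    refine le_trans ?_ ((le_abs_self _).trans (hK x hx))
    refine hasSum_le (fun k => ?_)
      (hasSum_channelPMF_mul (hp.expGrowth_log_div hlam hA hP)).summable.hasSum
      (hasSum_channelPMF_mul hc)
    refine mul_le_mul_of_nonneg_left ?_ (hp.pos hlam k).le
    exact (Real.log_le_self (div_pos (hp.pos hlam k) (hP.pos hlam k)).le).trans
      (hp.div_le hlam hA hP k)
  simpa [mutualInfo] using integral_mono_ae (hν.integrable (hν.continuousOn_iFun hlam hA))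
    (integrable_const K) hle

lemma IsInput.mutualInfo_le_capacity (hlam : 0 < lam) (hA : 0 < A) (hν : IsInput A ν) :
    mutualInfo lam ν ≤ capacity A lam :=
  le_csSup (bddAbove_mutualInfo hlam hA) ⟨ν, hν, rfl⟩

end PoissonChannel

section Optimality

variable {A lam : ℝ} {μ : Measure ℝ}

/-- The mixture `(1 - t) μ + t δ_a`. -/
def mixDirac (μ : Measure ℝ) (a t : ℝ) : Measure ℝ :=
  ENNReal.ofReal (1 - t) • μ + ENNReal.ofReal t • Measure.dirac a

lemma IsInput.mixDirac {a t : ℝ} (hμ : IsInput A μ) (ha : a ∈ Set.Icc 0 A) (h0 : 0 ≤ t)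
    (h1 : t ≤ 1) : IsInput A (mixDirac μ a t) := by
  have := hμ.1
  refine ⟨⟨?_⟩, ?_⟩
  · simp only [_root_.mixDirac, Measure.add_apply, Measure.smul_apply, measure_univ, smul_eq_mul,
      mul_one]
    rw [← ENNReal.ofReal_add (by linarith) h0, sub_add_cancel, ENNReal.ofReal_one]
  · simp [_root_.mixDirac, hμ.2, ha.1, ha.2]

lemma integral_mixDirac {a t : ℝ} (h0 : 0 ≤ t) (h1 : t ≤ 1) {g : ℝ → ℝ} (hg : Integrable g μ) :
    ∫ x, g x ∂mixDirac μ a t = (1 - t) * ∫ x, g x ∂μ + t * g a := by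
  rw [mixDirac, integral_add_measure (hg.smul_measure ENNReal.ofReal_ne_top)
    ((integrable_dirac (by simp)).smul_measure ENNReal.ofReal_ne_top), integral_smul_measure,
    integral_smul_measure, integral_dirac, ENNReal.toReal_ofReal h0,
    ENNReal.toReal_ofReal (by linarith), smul_eq_mul, smul_eq_mul]

/-- The Kuhn–Tucker inequality. -/
lemma IsCapacityAchieving.iFun_le (hlam : 0 < lam) (hA : 0 < A)
    (hμ : IsCapacityAchieving A lam μ) {a : ℝ} (ha : a ∈ Set.Icc 0 A) :
    iFun lam μ a ≤ capacity A lam := by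
  have hin := hμ.1
  have hP := poissonBounded_outputPMF hlam hin
  have hp := poissonBounded_channelPMF hlam ha
  set v : ℕ → ℝ := fun k => channelPMF lam a k / outputPMF lam μ k - 1
  have hv : ExpGrowth v := (hp.expGrowth_div hlam hA hP).sub .const_one
  set S : ℝ → ℝ := fun x => ∑' k, channelPMF lam x k * v k
  have hS : Continuous S := by
    simp only [S, (hasSum_channelPMF_mul hv).tsum_eq]
    exact continuous_exp_neg_mul_egf hv
  have hSμ : ∫ x, S x ∂μ = 0 := by
    refine (hin.hasSum_outputPMF_mul hlam hA hv).unique ?_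
    have := (hasSum_channelPMF (lam := lam) (x := a)).sub (hin.hasSum_outputPMF hlam hA)
    rw [sub_self] at this
    convert! this using 2 with k
    have := (hP.pos hlam k).ne'
    simp only [v]
    field_simp
  have key : ∀ t ∈ Set.Ioo (0 : ℝ) 1, iFun lam μ a - capacity A lam ≤ t * S a := by
    intro t ht
    have hmix := hin.mixDirac ha ht.1.le ht.2.le
    have hQ := poissonBounded_outputPMF hlam hmix
    have hQeq (k : ℕ) : outputPMF lam (mixDirac μ a t) k / outputPMF lam μ k - 1 = t * v k := by
      have hne := (hP.pos hlam k).ne'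
      have h : outputPMF lam (mixDirac μ a t) k =
          (1 - t) * outputPMF lam μ k + t * channelPMF lam a k :=
        integral_mixDirac ht.1.le ht.2.le (hin.integrable_channelPMF k)
      rw [h]
      simp only [v]
      field_simp
      ring
    have hlow : ∀ x ∈ Set.Icc 0 A,
        iFun lam μ x - t * S x ≤ iFun lam (mixDirac μ a t) x := by
      intro x hx
      have hx' := poissonBounded_channelPMF hlam hx
      refine hasSum_le (fun k => ?_)
        ((hasSum_channelPMF_mul (hx'.expGrowth_log_div hlam hA hP)).summable.hasSum.sub
          ((hasSum_channelPMF_mul hv).summable.hasSum.mul_left t))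
        (hasSum_channelPMF_mul (hx'.expGrowth_log_div hlam hA hQ)).summable.hasSum
      have h1 := hx'.pos hlam k
      have h2 := hP.pos hlam k
      have h3 := hQ.pos hlam k
      have h4 := Real.log_le_sub_one_of_pos (div_pos h3 h2)
      rw [hQeq, Real.log_div h3.ne' h2.ne'] at h4
      rw [Real.log_div h1.ne' h2.ne', Real.log_div h1.ne' h3.ne']
      nlinarith
    have hi := hin.integrable (hin.continuousOn_iFun hlam hA)
    have hSi := (hin.integrable hS.continuousOn).const_mul t
    have hmi := hin.integrable (hmix.continuousOn_iFun hlam hA)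
    have hint : capacity A lam ≤ ∫ x, iFun lam (mixDirac μ a t) x ∂μ := by
      have h := integral_mono_ae (hi.sub hSi) hmi (hin.ae_mem.mono hlow)
      simp only [Pi.sub_apply] at h
      rw [integral_sub hi hSi, integral_const_mul, hSμ, mul_zero, sub_zero] at h
      exact hμ.2.symm.trans_le h
    have hle := hmix.mutualInfo_le_capacity hlam hA
    rw [mutualInfo, integral_mixDirac ht.1.le ht.2.le hmi] at hle
    have ha' := hlow a ha
    nlinarith [mul_le_mul_of_nonneg_left hint (sub_nonneg.2 ht.2.le),
      mul_le_mul_of_nonneg_left ha' ht.1.le, ht.1]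
  have hlim : Filter.Tendsto (fun t : ℝ => t * S a) (nhdsWithin 0 (Set.Ioi 0)) (nhds 0) := by
    have : Continuous fun t : ℝ => t * S a := by fun_prop
    simpa using (this.tendsto 0).mono_left nhdsWithin_le_nhds
  exact sub_nonpos.1 (ge_of_tendsto hlim
    (Filter.eventually_of_mem (Ioo_mem_nhdsGT zero_lt_one) key))

lemma IsInput.msupport_subset (hμ : IsInput A μ) : msupport μ ⊆ Set.Icc 0 A := by
  intro x hx
  by_contra h
  exact (hx _ isClosed_Icc.isOpen_compl h).ne' hμ.2

/-- The Kuhn–Tucker equality on the support. -/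
lemma IsCapacityAchieving.infoFun_eq (hlam : 0 < lam) (hA : 0 < A)
    (hμ : IsCapacityAchieving A lam μ) {x : ℝ} (hx : x ∈ msupport μ) :
    infoFun lam μ (x + lam) = capacity A lam := by
  have hin := hμ.1
  have := hin.1
  have hi := hin.integrable (hin.continuousOn_iFun hlam hA)
  have hae : ∀ᵐ x ∂μ, infoFun lam μ (x + lam) = capacity A lam := by
    have h0 : 0 ≤ᵐ[μ] fun x => capacity A lam - iFun lam μ x :=
      hin.ae_mem.mono fun x hx => sub_nonneg.2 (hμ.iFun_le hlam hA hx)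
    have h1 : ∫ x, (capacity A lam - iFun lam μ x) ∂μ = 0 := by
      rw [integral_sub (integrable_const _) hi, integral_const]
      simpa [mutualInfo] using sub_eq_zero.2 hμ.2.symm
    rw [integral_eq_zero_iff_of_nonneg_ae h0 ((integrable_const _).sub hi)] at h1
    filter_upwards [h1, hin.ae_mem] with x hx hxA
    rw [← hin.iFun_eq_infoFun hlam hxA hA]
    exact (sub_eq_zero.1 hx).symm
  by_contra hne
  have hy : 0 < x + lam := by linarith [(hin.msupport_subset hx).1]
  have hc : ContinuousAt (fun x => infoFun lam μ (x + lam)) x :=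
    (hin.hasDerivAt_infoFun hlam hA hy).continuousAt.comp (f := fun x => x + lam) (by fun_prop)
  obtain ⟨U, hU, hUo, hxU⟩ := eventually_nhds_iff.1 (hc.eventually_ne hne)
  exact (hx U hUo hxU).ne' (measure_mono_null hU hae)

/-- Zero counting for level sets of the averaged information density. -/
lemma IsInput.card_levelSet_le (hlam : 0 < lam) (hA : 0 < A) (hμ : IsInput A μ) {v : ℝ}
    (s : Finset ℝ) (hs : ∀ y ∈ s, y ∈ Set.Icc lam (A + lam) ∧ infoFun lam μ y = v) :
    (s.card : ℝ) ≤ 2 + Real.log (1 + Real.exp 1 * (A + lam) *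
      Real.exp (2 * (Real.exp 1 * (A + lam))) * Real.log ((A + lam) / lam)) := by
  have hord : (Set.Icc lam (A + lam)).OrdConnected := Set.ordConnected_Icc
  have hpos {y : ℝ} (hy : y ∈ Set.Icc lam (A + lam)) : 0 < y := hlam.trans_le hy.1
  obtain ⟨t, ht, hst⟩ := exists_finset_deriv_eq_zero hord
    (fun y hy => hμ.hasDerivAt_infoFun hlam hA (hpos hy)) s hs
  obtain ⟨u, hu, htu⟩ := exists_finset_deriv_eq_zero hord
    (fun y hy => (Real.hasDerivAt_log (hpos hy).ne').sub
      ((hμ.expGrowth_logOutput_succ_sub hlam hA).hasDerivAt_exp_neg_mul_egf y)) t ht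
  set d : ℕ → ℝ := fun k => (logOutput lam μ (k + 1 + 1) - logOutput lam μ (k + 1)) -
    (logOutput lam μ (k + 1) - logOutput lam μ k)
  have hd : ∀ k, |d k| ≤ Real.log ((A + lam) / lam) :=
    hμ.abs_logOutput_second_difference_le hlam hA
  set L := Real.log ((A + lam) / lam)
  have hL : 0 ≤ L := (abs_nonneg _).trans (hd 0)
  have hdg : ExpGrowth d := .of_bounded L hd
  set ρ := Real.exp 1 * (A + lam)
  have hR : 0 < A + lam := by positivity
  have hRρ : A + lam < ρ := by
    have := Real.add_one_lt_exp one_ne_zero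
    nlinarith
  have hdiff : Differentiable ℂ (egf ℂ d) := fun z => (hdg.hasDerivAt_egf z).differentiableAt
  have key := norm_mul_pow_card_le (M := 1 + ρ * Real.exp (2 * ρ) * L) hR hRρ
    (u.map ⟨((↑) : ℝ → ℂ), Complex.ofReal_injective⟩)
    (fun z => 1 - z * (Complex.exp (-z) * egf ℂ d z))
    (by fun_prop) (fun z hz => ?_) (fun a ha => ?_)
  · rw [Finset.card_map, mul_div_cancel_right₀ _ hR.ne', ← Real.exp_nat_mul] at key
    simp only [zero_mul, sub_zero, norm_one, one_mul, mul_one] at key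
    have hlog := (Real.le_log_iff_exp_le (by positivity)).2 key
    have : (s.card : ℝ) ≤ u.card + 2 := by exact_mod_cast (by omega : s.card ≤ u.card + 2)
    linarith
  · have h1 : ‖Complex.exp (-z)‖ ≤ Real.exp ρ := by
      simpa [hz] using Complex.norm_exp_le_exp_norm (-z)
    have h2 : ‖egf ℂ d z‖ ≤ L * Real.exp ρ := hz ▸ norm_egf_le hd z
    calc ‖1 - z * (Complex.exp (-z) * egf ℂ d z)‖
        ≤ ‖(1 : ℂ)‖ + ‖z * (Complex.exp (-z) * egf ℂ d z)‖ := norm_sub_le _ _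
      _ = 1 + ρ * (‖Complex.exp (-z)‖ * ‖egf ℂ d z‖) := by
        rw [norm_one, norm_mul, norm_mul, hz]
      _ ≤ 1 + ρ * (Real.exp ρ * (L * Real.exp ρ)) := by gcongr
      _ = _ := by rw [two_mul, Real.exp_add]; ring
  · obtain ⟨y, hy, rfl⟩ := Finset.mem_map.1 ha
    obtain ⟨hyD, hy0⟩ := hu y hy
    have hy' := hpos hyD
    refine ⟨by simpa [abs_of_pos hy'] using hyD.2, ?_⟩
    have h : 1 - y * (Real.exp (-y) * egf ℝ d y) = 0 := by
      rw [← mul_zero y, ← hy0]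
      field_simp
    simpa [ofReal_egf] using congrArg ((↑) : ℝ → ℂ) h

end Optimality

/-- Upper bound on the number of support points, positive dark current. -/
theorem support_card_upper_bound_positive_dark_current (A lam : ℝ) (hA : 0 < A)
    (hlam : 0 < lam) (hAe : Real.exp 1 < A + lam)
    (μ : Measure ℝ) (hμ : IsCapacityAchieving A lam μ) :
    (msupport μ).Finite ∧
      ((msupport μ).ncard : ℤ) ≤
        ⌊3 + Real.log (1 + (Real.exp 1 * (A + lam) + 2 * lam) *
          Real.exp (2 * (Real.exp 1 * (A + lam) + lam)) *
          Real.log ((A + lam) / lam))⌋ := by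
  have hin := hμ.1
  set B := Real.log (1 + (Real.exp 1 * (A + lam) + 2 * lam) *
          Real.exp (2 * (Real.exp 1 * (A + lam) + lam)) *
          Real.log ((A + lam) / lam)) with hB
  have hL : 0 ≤ Real.log ((A + lam) / lam) :=
    Real.log_nonneg ((one_le_div hlam).2 (by linarith))
  have hbound (s : Finset ℝ) (hs : ↑s ⊆ msupport μ) : (s.card : ℝ) ≤ 2 + B := by
    have h := hin.card_levelSet_le hlam hA (s.map (addRightEmbedding lam)) (v := capacity A lam)
      (fun y hy => ?_)
    · rw [Finset.card_map] at h
      refine h.trans ?_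
      rw [hB]
      gcongr <;> linarith
    · obtain ⟨x, hx, rfl⟩ := Finset.mem_map.1 hy
      have hxI := hin.msupport_subset (hs hx)
      exact ⟨⟨by simpa using hxI.1, by simpa using hxI.2⟩, hμ.infoFun_eq hlam hA (hs hx)⟩
  have hfin : (msupport μ).Finite := by
    by_contra hinf
    obtain ⟨s, hs, hcard⟩ := Set.Infinite.exists_subset_card_eq hinf (⌊2 + B⌋₊ + 1)
    have := hbound s hs
    rw [hcard] at this
    push_cast at this
    linarith [Nat.lt_floor_add_one (2 + B)]
  refine ⟨hfin, Int.le_floor.2 ?_⟩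
  have := hbound hfin.toFinset (by simp)
  rw [← Set.ncard_eq_toFinset_card _ hfin] at this
  push_cast
  linarith
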